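/- Let F₀ determine a strictly weak, left invariant Finsler metric on a Hilbertian H-type group M = V ⊕ W. Then for all x, y ∈ V and z₁, z₂ ∈ W one has d_F(x + z₁, y + z₂) = 0 if and only if x = y. -/

import Mathlib

open scoped RealInnerProductSpace

/-- A Hilbertian H-type group: a real Hilbert space `M` with an orthogonal decomposition
`M = V ⊕ W` into nontrivial closed subspaces, `W` finite dimensional, a continuous
skew-symmetric Lie bracket with `[M,M] ⊆ W`, `[M,W] = 0`, and the map `J` determined by
`⟪J z x, y⟫ = ⟪z, [x,y]⟫` satisfying `J_z ∘ J_z = -‖z‖² id` on `V`. -/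
structure HTypeGroup (M : Type*) [NormedAddCommGroup M] [InnerProductSpace ℝ M]
    [CompleteSpace M] where
  V : Submodule ℝ M
  W : Submodule ℝ M
  V_closed : IsClosed (V : Set M)
  W_closed : IsClosed (W : Set M)
  V_nontrivial : V ≠ ⊥
  W_nontrivial : W ≠ ⊥
  W_findim : FiniteDimensional ℝ ↥W
  orthogonal : ∀ v ∈ V, ∀ w ∈ W, ⟪v, w⟫ = 0
  proj1 : M →L[ℝ] M
  proj2 : M →L[ℝ] M
  proj1_mem : ∀ v : M, proj1 v ∈ V
  proj2_mem : ∀ v : M, proj2 v ∈ W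
  proj_add : ∀ v : M, proj1 v + proj2 v = v
  bracket : M →L[ℝ] M →L[ℝ] M
  bracket_skew : ∀ u v : M, bracket u v = - bracket v u
  bracket_mem_W : ∀ u v : M, bracket u v ∈ W
  bracket_W : ∀ u : M, ∀ w ∈ W, bracket u w = 0
  Jmap : M →L[ℝ] M →L[ℝ] M
  Jmap_mem_V : ∀ z ∈ W, ∀ x ∈ V, Jmap z x ∈ V
  Jmap_inner : ∀ z ∈ W, ∀ x ∈ V, ∀ y ∈ V, ⟪Jmap z x, y⟫ = ⟪z, bracket x y⟫
  Jmap_sq : ∀ z ∈ W, ∀ x ∈ V, Jmap z (Jmap z x) = -(‖z‖ ^ 2) • x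

/-- A continuous, piecewise continuously differentiable curve on `[0,1]`: a continuous
curve together with a derivative function which is the honest derivative away from a
finite exceptional set, and which is interval integrable. -/
structure PC1Curve (M : Type*) [NormedAddCommGroup M] [NormedSpace ℝ M] where
  toFun : ℝ → M
  deriv : ℝ → M
  continuousOn : ContinuousOn toFun (Set.Icc 0 1)
  exc : Set ℝ
  exc_finite : exc.Finite
  hasDeriv : ∀ t ∈ Set.Ioo (0 : ℝ) 1 \ exc, HasDerivAt toFun (deriv t) t
  deriv_integrable : IntervalIntegrable deriv MeasureTheory.volume 0 1

/-- The Finsler length `ℓ_F(γ) = ∫₀¹ F₀(γ'(t) - (1/2)[γ(t), γ'(t)]) dt` of a piecewise `C¹`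
curve, with respect to the left invariant Finsler metric determined by the norm `F₀`. -/
noncomputable def finslerLength {M : Type*} [NormedAddCommGroup M] [InnerProductSpace ℝ M]
    [CompleteSpace M] (H : HTypeGroup M) (F₀ : M → ℝ) (γ : PC1Curve M) : ℝ :=
  ∫ t in (0 : ℝ)..1, F₀ (γ.deriv t - (2⁻¹ : ℝ) • H.bracket (γ.toFun t) (γ.deriv t))

/-- The Finsler distance `d_F(p, q)`: the infimum of the Finsler lengths of continuous,
piecewise continuously differentiable curves joining `p` to `q`. -/
noncomputable def finslerDist {M : Type*} [NormedAddCommGroup M] [InnerProductSpace ℝ M]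
    [CompleteSpace M] (H : HTypeGroup M) (F₀ : M → ℝ) (p q : M) : ℝ :=
  sInf {L : ℝ | ∃ γ : PC1Curve M, γ.toFun 0 = p ∧ γ.toFun 1 = q ∧ L = finslerLength H F₀ γ}

section Seminorm

variable {E : Type*} [NormedAddCommGroup E] [NormedSpace ℝ E] {F : E → ℝ}

theorem nonneg_of_subadditive_of_absHomogeneous (hadd : ∀ u v : E, F (u + v) ≤ F u + F v)
    (hsmul : ∀ (c : ℝ) (v : E), F (c • v) = |c| * F v) (v : E) : 0 ≤ F v := by
  have h0 : F 0 = 0 := by simpa using hsmul 0 0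
  have h1 : F (-v) = F v := by simpa using hsmul (-1) v
  have h2 := hadd v (-v)
  rw [add_neg_cancel, h0, h1] at h2
  linarith

theorem continuous_of_subadditive_of_le_norm {E : Type*} [NormedAddCommGroup E] {F : E → ℝ}
    (hadd : ∀ u v : E, F (u + v) ≤ F u + F v)
    {c : ℝ} (hc : 0 ≤ c) (hF : ∀ v : E, F v ≤ c * ‖v‖) : Continuous F := by
  refine (LipschitzWith.of_le_add_mul c.toNNReal fun x y => ?_).continuous
  have h := hadd y (x - y)
  rw [add_sub_cancel] at h
  rw [Real.coe_toNNReal c hc, dist_eq_norm]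
  linarith [hF (x - y)]

theorem convexOn_of_subadditive_of_absHomogeneous (hadd : ∀ u v : E, F (u + v) ≤ F u + F v)
    (hsmul : ∀ (c : ℝ) (v : E), F (c • v) = |c| * F v) : ConvexOn ℝ Set.univ F := by
  refine ⟨convex_univ, fun x _ y _ a b ha hb _ => ?_⟩
  have h := hadd (a • x) (b • y)
  rwa [hsmul, hsmul, abs_of_nonneg ha, abs_of_nonneg hb] at h

/-- On a finite-dimensional subspace, a continuous definite norm dominates the ambient norm. -/
theorem Submodule.exists_mul_norm_le_of_definite (W : Submodule ℝ E) [FiniteDimensional ℝ W]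
    (hcont : Continuous F) (hnonneg : ∀ v, 0 ≤ F v)
    (hsmul : ∀ (c : ℝ) (v : E), F (c • v) = |c| * F v) (hdef : ∀ v : E, F v = 0 → v = 0) :
    ∃ m > 0, ∀ w ∈ W, m * ‖w‖ ≤ F w := by
  have : ProperSpace W := FiniteDimensional.proper_real W
  rcases (Metric.sphere (0 : W) 1).eq_empty_or_nonempty with hS | hS
  · refine ⟨1, one_pos, fun w hw => ?_⟩
    by_cases hw0 : w = 0
    · simpa [hw0] using hnonneg 0
    · have hmem : (‖w‖⁻¹ • (⟨w, hw⟩ : W)) ∈ Metric.sphere (0 : W) 1 := by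
        simp [norm_smul, hw0]
      simp [hS] at hmem
  · obtain ⟨s, hs, hmin⟩ := (isCompact_sphere (0 : W) 1).exists_isMinOn hS
      (hcont.comp continuous_subtype_val).continuousOn
    have hs0 : (s : E) ≠ 0 := by
      intro h
      have : s = 0 := Subtype.ext h
      simp [this] at hs
    refine ⟨F s, lt_of_le_of_ne (hnonneg s) fun h => hs0 (hdef _ h.symm), fun w hw => ?_⟩
    by_cases hw0 : w = 0
    · simpa [hw0] using hnonneg 0
    · have hpos : 0 < ‖w‖ := norm_pos_iff.mpr hw0
      have hmem : (‖w‖⁻¹ • (⟨w, hw⟩ : W)) ∈ Metric.sphere (0 : W) 1 := by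
        simp [norm_smul, hw0]
      have h : F s ≤ F (‖w‖⁻¹ • w) := hmin hmem
      rw [hsmul, abs_of_pos (inv_pos.mpr hpos), inv_mul_eq_div, le_div_iff₀ hpos] at h
      exact h

/-- The triangle inequality for integrals over the unit interval. -/
theorem map_intervalIntegral_le_of_subadditive (hadd : ∀ u v : E, F (u + v) ≤ F u + F v)
    (hsmul : ∀ (c : ℝ) (v : E), F (c • v) = |c| * F v) (hcont : Continuous F) [CompleteSpace E]
    {g : ℝ → E} (hg : IntervalIntegrable g MeasureTheory.volume 0 1)
    (hFg : IntervalIntegrable (fun t => F (g t)) MeasureTheory.volume 0 1) :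
    F (∫ t in (0 : ℝ)..1, g t) ≤ ∫ t in (0 : ℝ)..1, F (g t) := by
  rw [intervalIntegrable_iff_integrableOn_Ioc_of_le zero_le_one] at hg hFg
  rw [intervalIntegral.integral_of_le zero_le_one, intervalIntegral.integral_of_le zero_le_one]
  have : MeasureTheory.IsProbabilityMeasure
      (MeasureTheory.volume.restrict (Set.Ioc (0 : ℝ) 1)) := ⟨by simp⟩
  exact (convexOn_of_subadditive_of_absHomogeneous hadd hsmul).map_integral_le
    hcont.continuousOn isClosed_univ (by simp) hg hFg

theorem IntervalIntegrable.comp_of_le_norm {E : Type*} [NormedAddCommGroup E] {F : E → ℝ}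
    (hcont : Continuous F) (hnonneg : ∀ v, 0 ≤ F v)
    {c a b : ℝ} (hF : ∀ v : E, F v ≤ c * ‖v‖) {g : ℝ → E}
    (hg : IntervalIntegrable g MeasureTheory.volume a b) :
    IntervalIntegrable (fun t => F (g t)) MeasureTheory.volume a b := by
  refine (hg.norm.const_mul c).mono_fun
    (hcont.comp_aestronglyMeasurable hg.aestronglyMeasurable_restrict_uIoc) ?_
  refine Filter.Eventually.of_forall fun t => ?_
  simp only [Real.norm_eq_abs]
  rw [abs_of_nonneg (hnonneg _)]
  exact (hF _).trans (le_abs_self _)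

end Seminorm

namespace HTypeGroup

variable {M : Type*} [NormedAddCommGroup M] [InnerProductSpace ℝ M] [CompleteSpace M]
  (H : HTypeGroup M)

theorem eq_zero_of_mem_V_of_mem_W {v : M} (hV : v ∈ H.V) (hW : v ∈ H.W) : v = 0 :=
  inner_self_eq_zero.mp (H.orthogonal v hV v hW)

theorem proj1_of_mem_V {v : M} (hv : v ∈ H.V) : H.proj1 v = v := by
  have h := H.proj_add v
  have h2 : v - H.proj1 v = H.proj2 v := sub_eq_of_eq_add' h.symm
  have h3 := H.eq_zero_of_mem_V_of_mem_W (H.V.sub_mem hv (H.proj1_mem v))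
    (h2 ▸ H.proj2_mem v)
  exact (sub_eq_zero.mp h3).symm

theorem proj1_of_mem_W {w : M} (hw : w ∈ H.W) : H.proj1 w = 0 := by
  have h2 : H.proj1 w = w - H.proj2 w := eq_sub_of_add_eq (H.proj_add w)
  exact H.eq_zero_of_mem_V_of_mem_W (H.proj1_mem w) (h2 ▸ H.W.sub_mem hw (H.proj2_mem w))

theorem bracket_self (u : M) : H.bracket u u = 0 :=
  (smul_eq_zero_iff_right (two_ne_zero (α := ℝ))).mp <| by
    rw [two_smul, ← eq_neg_iff_add_eq_zero]
    exact H.bracket_skew u u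

theorem bracket_of_mem_W_left {w : M} (hw : w ∈ H.W) (u : M) : H.bracket w u = 0 := by
  rw [H.bracket_skew, H.bracket_W u w hw, neg_zero]

theorem inner_Jmap_self {z v : M} (hz : z ∈ H.W) (hv : v ∈ H.V) :
    ⟪H.Jmap z v, H.Jmap z v⟫ = ‖z‖ ^ 2 * ⟪v, v⟫ := by
  have hJ := H.Jmap_mem_V z hz v hv
  rw [H.Jmap_inner z hz v hv _ hJ, H.bracket_skew, inner_neg_right,
    ← H.Jmap_inner z hz _ hJ v hv, H.Jmap_sq z hz v hv, inner_smul_left]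
  simp

theorem inner_Jmap_Jmap {w z v : M} (hw : w ∈ H.W) (hz : z ∈ H.W) (hv : v ∈ H.V) :
    ⟪H.Jmap w v, H.Jmap z v⟫ = ⟪w, z⟫ * ‖v‖ ^ 2 := by
  have h := H.inner_Jmap_self (H.W.add_mem hw hz) hv
  have h1 := H.inner_Jmap_self hw hv
  have h2 := H.inner_Jmap_self hz hv
  rw [map_add, add_apply, inner_add_add_self, norm_add_sq_real,
    real_inner_comm (H.Jmap w v) (H.Jmap z v), h1, h2] at h
  rw [← real_inner_self_eq_norm_sq v]
  linarith

theorem bracket_Jmap {z v : M} (hz : z ∈ H.W) (hv : v ∈ H.V) :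
    H.bracket v (H.Jmap z v) = ‖v‖ ^ 2 • z := by
  have hmem : H.bracket v (H.Jmap z v) - ‖v‖ ^ 2 • z ∈ H.W :=
    H.W.sub_mem (H.bracket_mem_W _ _) (H.W.smul_mem _ hz)
  refine sub_eq_zero.mp ((inner_self_eq_zero (𝕜 := ℝ)).mp ?_)
  generalize hw : H.bracket v (H.Jmap z v) - ‖v‖ ^ 2 • z = w at hmem
  conv_lhs => rw [← hw]
  rw [real_inner_comm, hw]
  nth_rewrite 2 [← hw]
  rw [inner_sub_right, inner_smul_right, ← H.Jmap_inner w hmem v hv _ (H.Jmap_mem_V z hz v hv),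
    H.inner_Jmap_Jmap hmem hz hv]
  ring

end HTypeGroup

section Curves

variable {M : Type*} [NormedAddCommGroup M] [InnerProductSpace ℝ M] [CompleteSpace M]

/-- The curve starting at `p` whose left-translated velocity is
`(1 - 2t) u + (2t - 3t²) w`. -/
noncomputable def HTypeGroup.commutatorCurve (H : HTypeGroup M) (p u w : M) : PC1Curve M where
  toFun t := p + (t - t ^ 2) • (u + (2⁻¹ : ℝ) • H.bracket p u)
    + (t ^ 2 - t ^ 3) • (w + (2⁻¹ : ℝ) • H.bracket p w)
    + (t ^ 3 / 3 - t ^ 4 / 2 + t ^ 5 / 5) • (2⁻¹ : ℝ) • H.bracket u w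
  deriv t := (1 - 2 * t) • (u + (2⁻¹ : ℝ) • H.bracket p u)
    + (2 * t - 3 * t ^ 2) • (w + (2⁻¹ : ℝ) • H.bracket p w)
    + (t ^ 2 - 2 * t ^ 3 + t ^ 4) • (2⁻¹ : ℝ) • H.bracket u w
  continuousOn := by fun_prop
  exc := ∅
  exc_finite := Set.finite_empty
  hasDeriv t _ := by
    have h1 : HasDerivAt (fun t : ℝ => t - t ^ 2) (1 - 2 * t) t :=
      ((hasDerivAt_id' t).fun_sub (hasDerivAt_pow 2 t)).congr_deriv (by simp)
    have h2 : HasDerivAt (fun t : ℝ => t ^ 2 - t ^ 3) (2 * t - 3 * t ^ 2) t :=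
      ((hasDerivAt_pow 2 t).fun_sub (hasDerivAt_pow 3 t)).congr_deriv (by simp)
    have h3 : HasDerivAt (fun t : ℝ => t ^ 3 / 3 - t ^ 4 / 2 + t ^ 5 / 5)
        (t ^ 2 - 2 * t ^ 3 + t ^ 4) t :=
      ((((hasDerivAt_pow 3 t).div_const 3).fun_sub ((hasDerivAt_pow 4 t).div_const 2)).fun_add
        ((hasDerivAt_pow 5 t).div_const 5)).congr_deriv (by push_cast; ring)
    exact (((h1.smul_const _).const_add p).add (h2.smul_const _)).add (h3.smul_const _)
  deriv_integrable := Continuous.intervalIntegrable (by fun_prop) _ _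

theorem HTypeGroup.commutatorCurve_velocity (H : HTypeGroup M) (p u w : M) (t : ℝ) :
    (H.commutatorCurve p u w).deriv t - (2⁻¹ : ℝ) • H.bracket
      ((H.commutatorCurve p u w).toFun t) ((H.commutatorCurve p u w).deriv t) =
      (1 - 2 * t) • u + (2 * t - 3 * t ^ 2) • w := by
  have hW (a b c : M) : H.bracket a (H.bracket b c) = 0 :=
    H.bracket_W a _ (H.bracket_mem_W b c)
  have hW' (a b c : M) : H.bracket (H.bracket b c) a = 0 :=
    H.bracket_of_mem_W_left (H.bracket_mem_W b c) a
  simp only [HTypeGroup.commutatorCurve, map_add, map_smul, add_apply, smul_apply,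
    hW, hW', H.bracket_self, H.bracket_skew w u, smul_zero, add_zero]
  module

theorem HTypeGroup.finslerLength_commutatorCurve_le (H : HTypeGroup M) {F₀ : M → ℝ}
    (hadd : ∀ u v : M, F₀ (u + v) ≤ F₀ u + F₀ v)
    (hsmul : ∀ (c : ℝ) (v : M), F₀ (c • v) = |c| * F₀ v) (hcont : Continuous F₀) (p u w : M) :
    finslerLength H F₀ (H.commutatorCurve p u w) ≤ F₀ u + F₀ w := by
  have hnonneg := nonneg_of_subadditive_of_absHomogeneous hadd hsmul
  simp only [finslerLength, H.commutatorCurve_velocity]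
  calc ∫ t in (0 : ℝ)..1, F₀ ((1 - 2 * t) • u + (2 * t - 3 * t ^ 2) • w)
      ≤ ∫ _ in (0 : ℝ)..1, (F₀ u + F₀ w) := by
        refine intervalIntegral.integral_mono_on zero_le_one
          (Continuous.intervalIntegrable (by fun_prop) _ _) (by simp) fun t ht => ?_
        refine (hadd _ _).trans ?_
        rw [hsmul, hsmul]
        obtain ⟨h0, h1⟩ := ht
        have hu : |1 - 2 * t| ≤ 1 := abs_le.mpr ⟨by linarith, by linarith⟩
        have hw : |2 * t - 3 * t ^ 2| ≤ 1 := abs_le.mpr ⟨by nlinarith, by nlinarith⟩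
        exact add_le_add (mul_le_of_le_one_left (hnonneg u) hu)
          (mul_le_of_le_one_left (hnonneg w) hw)
    _ = F₀ u + F₀ w := by simp

theorem finslerLength_nonneg (H : HTypeGroup M) {F₀ : M → ℝ} (hnonneg : ∀ v, 0 ≤ F₀ v)
    (γ : PC1Curve M) : 0 ≤ finslerLength H F₀ γ :=
  intervalIntegral.integral_nonneg zero_le_one fun _ _ => hnonneg _

theorem PC1Curve.integral_deriv (γ : PC1Curve M) :
    ∫ t in (0 : ℝ)..1, γ.deriv t = γ.toFun 1 - γ.toFun 0 :=
  MeasureTheory.integral_eq_of_hasDerivAt_off_countable_of_le _ _ zero_le_one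
    γ.exc_finite.countable γ.continuousOn γ.hasDeriv γ.deriv_integrable

theorem HTypeGroup.intervalIntegrable_velocity (H : HTypeGroup M) (γ : PC1Curve M) :
    IntervalIntegrable
      (fun t => γ.deriv t - (2⁻¹ : ℝ) • H.bracket (γ.toFun t) (γ.deriv t))
      MeasureTheory.volume 0 1 := by
  refine γ.deriv_integrable.sub (IntervalIntegrable.smul ?_ _)
  obtain ⟨B, hB⟩ := isCompact_Icc.exists_bound_of_continuousOn γ.continuousOn
  have hI := γ.deriv_integrable
  rw [intervalIntegrable_iff_integrableOn_Ioc_of_le zero_le_one] at hI ⊢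
  have hmeas : MeasureTheory.AEStronglyMeasurable γ.toFun
      (MeasureTheory.volume.restrict (Set.Ioc (0 : ℝ) 1)) :=
    (γ.continuousOn.mono Set.Ioc_subset_Icc_self).aestronglyMeasurable
      measurableSet_Ioc
  refine (hI.norm.const_mul (‖H.bracket‖ * B)).mono'
    (H.bracket.aestronglyMeasurable_comp₂ hmeas hI.aestronglyMeasurable) ?_
  filter_upwards [MeasureTheory.ae_restrict_mem measurableSet_Ioc] with t ht
  refine (H.bracket.le_opNorm₂ _ _).trans ?_
  have := hB t (Set.Ioc_subset_Icc_self ht)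
  gcongr

/-- The length of a curve controls the distance of the `V`-components of its endpoints. -/
theorem HTypeGroup.map_proj1_sub_le_finslerLength (H : HTypeGroup M) {F₀ : M → ℝ}
    (hadd : ∀ u v : M, F₀ (u + v) ≤ F₀ u + F₀ v)
    (hsmul : ∀ (c : ℝ) (v : M), F₀ (c • v) = |c| * F₀ v)
    {c : ℝ} (hc : 0 ≤ c) (hle : ∀ v : M, F₀ v ≤ c * ‖v‖)
    {C : ℝ} (hproj : ∀ v : M, F₀ (H.proj1 v) ≤ C * F₀ v) (γ : PC1Curve M) :
    F₀ (H.proj1 (γ.toFun 1 - γ.toFun 0)) ≤ C * finslerLength H F₀ γ := by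
  have hcont := continuous_of_subadditive_of_le_norm hadd hc hle
  have hnonneg := nonneg_of_subadditive_of_absHomogeneous hadd hsmul
  have hI : IntervalIntegrable (fun t => H.proj1 (γ.deriv t)) MeasureTheory.volume 0 1 :=
    ⟨H.proj1.integrable_comp γ.deriv_integrable.1, H.proj1.integrable_comp γ.deriv_integrable.2⟩
  have hFI := hI.comp_of_le_norm hcont hnonneg hle
  have hFV := (H.intervalIntegrable_velocity γ).comp_of_le_norm hcont hnonneg hle
  rw [← γ.integral_deriv, ← H.proj1.intervalIntegral_comp_comm γ.deriv_integrable]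
  refine (map_intervalIntegral_le_of_subadditive hadd hsmul hcont hI hFI).trans ?_
  rw [finslerLength, ← intervalIntegral.integral_const_mul]
  refine intervalIntegral.integral_mono_on zero_le_one hFI (hFV.const_mul C) fun t _ => ?_
  have h := hproj (γ.deriv t - (2⁻¹ : ℝ) • H.bracket (γ.toFun t) (γ.deriv t))
  rwa [map_sub, map_smul, H.proj1_of_mem_W (H.bracket_mem_W _ _), smul_zero, sub_zero] at h

/-- A strictly weak norm is already strictly weak on `V`. -/
theorem HTypeGroup.exists_mem_V_map_le (H : HTypeGroup M) {F₀ : M → ℝ}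
    (hcont : Continuous F₀) (hnonneg : ∀ v, 0 ≤ F₀ v)
    (hsmul : ∀ (c : ℝ) (v : M), F₀ (c • v) = |c| * F₀ v)
    (hdef : ∀ v : M, F₀ v = 0 → v = 0) {C : ℝ} (hC : 0 < C)
    (hproj : ∀ v : M, F₀ (H.proj1 v) ≤ C * F₀ v ∧ F₀ (H.proj2 v) ≤ C * F₀ v)
    (hweak : ¬ ∃ c > (0 : ℝ), ∀ v : M, c * ‖v‖ ≤ F₀ v) {ε : ℝ} (hε : 0 < ε) :
    ∃ v ∈ H.V, v ≠ 0 ∧ F₀ v ≤ ε * ‖v‖ := by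
  by_contra! hV
  have := H.W_findim
  obtain ⟨m, hm, hW⟩ := H.W.exists_mul_norm_le_of_definite hcont hnonneg hsmul hdef
  refine hweak ⟨(C / ε + C / m)⁻¹, by positivity, fun v => ?_⟩
  have h1 : ε * ‖H.proj1 v‖ ≤ C * F₀ v := by
    refine le_trans ?_ (hproj v).1
    by_cases h0 : H.proj1 v = 0
    · simpa [h0] using hnonneg 0
    · exact (hV _ (H.proj1_mem v) h0).le
  have h2 : m * ‖H.proj2 v‖ ≤ C * F₀ v := (hW _ (H.proj2_mem v)).trans (hproj v).2
  have h3 : ‖v‖ ≤ ‖H.proj1 v‖ + ‖H.proj2 v‖ := by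
    conv_lhs => rw [← H.proj_add v]
    exact norm_add_le _ _
  rw [inv_mul_le_iff₀ (by positivity), add_mul, div_mul_eq_mul_div, div_mul_eq_mul_div]
  rw [mul_comm, ← le_div_iff₀ hε] at h1
  rw [mul_comm, ← le_div_iff₀ hm] at h2
  linarith

/-- Every vector of `W` is a bracket of two arbitrarily short vectors. -/
theorem HTypeGroup.exists_bracket_eq_map_le (H : HTypeGroup M) {F₀ : M → ℝ}
    (hsmul : ∀ (c : ℝ) (v : M), F₀ (c • v) = |c| * F₀ v)
    {c : ℝ} (hc : 0 ≤ c) (hle : ∀ v : M, F₀ v ≤ c * ‖v‖)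
    (hV : ∀ ε > 0, ∃ v ∈ H.V, v ≠ 0 ∧ F₀ v ≤ ε * ‖v‖) {z : M} (hz : z ∈ H.W)
    {ε : ℝ} (hε : 0 < ε) :
    ∃ u w, H.bracket u w = z ∧ F₀ u ≤ ε ∧ F₀ w ≤ c * ‖H.Jmap z‖ * ε := by
  obtain ⟨v, hv, hv0, hF⟩ := hV (ε ^ 2) (by positivity)
  have hpos : 0 < ‖v‖ := norm_pos_iff.mpr hv0
  refine ⟨(ε * ‖v‖)⁻¹ • v, (ε / ‖v‖) • H.Jmap z v, ?_, ?_, ?_⟩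
  · rw [map_smul, map_smul, smul_apply, H.bracket_Jmap hz hv, smul_smul, smul_smul]
    have : ε / ‖v‖ * (ε * ‖v‖)⁻¹ * ‖v‖ ^ 2 = 1 := by field_simp
    rw [this, one_smul]
  · rw [hsmul, abs_of_pos (by positivity), inv_mul_le_iff₀ (by positivity)]
    linarith
  · rw [hsmul, abs_of_pos (by positivity)]
    have h : F₀ (H.Jmap z v) ≤ c * (‖H.Jmap z‖ * ‖v‖) :=
      (hle _).trans (by gcongr; exact (H.Jmap z).le_opNorm v)
    calc ε / ‖v‖ * F₀ (H.Jmap z v) ≤ ε / ‖v‖ * (c * (‖H.Jmap z‖ * ‖v‖)) := by gcongr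
      _ = c * ‖H.Jmap z‖ * ε := by field_simp

end Curves

/-- For a strictly weak, left invariant Finsler metric `F₀` on a
Hilbertian H-type group `M = V ⊕ W`, for all `x, y ∈ V` and `z₁, z₂ ∈ W` one has
`d_F(x + z₁, y + z₂) = 0` if and only if `x = y`. -/
theorem statement_10 {M : Type*} [NormedAddCommGroup M] [InnerProductSpace ℝ M]
    [CompleteSpace M] (H : HTypeGroup M) (F₀ : M → ℝ)
    (hF_add : ∀ u v : M, F₀ (u + v) ≤ F₀ u + F₀ v)
    (hF_smul : ∀ (c : ℝ) (v : M), F₀ (c • v) = |c| * F₀ v)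
    (hF_def : ∀ v : M, F₀ v = 0 → v = 0)
    (c₁ : ℝ) (hc₁ : 0 < c₁) (hF_cont : ∀ v : M, F₀ v ≤ c₁ * ‖v‖)
    (C : ℝ) (hC : 0 < C)
    (hF_proj : ∀ v : M, F₀ (H.proj1 v) ≤ C * F₀ v ∧ F₀ (H.proj2 v) ≤ C * F₀ v)
    (h_strictly_weak : ¬ ∃ c > (0 : ℝ), ∀ v : M, c * ‖v‖ ≤ F₀ v) :
    ∀ x ∈ H.V, ∀ y ∈ H.V, ∀ z₁ ∈ H.W, ∀ z₂ ∈ H.W,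
      (finslerDist H F₀ (x + z₁) (y + z₂) = 0 ↔ x = y) := by
  have hnonneg := nonneg_of_subadditive_of_absHomogeneous hF_add hF_smul
  have hcont := continuous_of_subadditive_of_le_norm hF_add hc₁.le hF_cont
  intro x hx y hy z₁ hz₁ z₂ hz₂
  constructor
  · intro hd
    have hne : {L : ℝ | ∃ γ : PC1Curve M, γ.toFun 0 = x + z₁ ∧ γ.toFun 1 = y + z₂ ∧
        L = finslerLength H F₀ γ}.Nonempty := by
      refine ⟨_, ⟨AffineMap.lineMap (x + z₁) (y + z₂), fun _ => y + z₂ - (x + z₁),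
        AffineMap.lineMap_continuous.continuousOn, ∅, Set.finite_empty,
        fun t _ => AffineMap.hasDerivAt_lineMap, by simp⟩, by simp, by simp, rfl⟩
    have hle : F₀ (y - x) / C ≤ 0 := by
      rw [← hd]
      refine le_csInf hne ?_
      rintro _ ⟨γ, h0, h1, rfl⟩
      have h := H.map_proj1_sub_le_finslerLength hF_add hF_smul hc₁.le hF_cont
        (fun v => (hF_proj v).1) γ
      rw [h0, h1, map_sub, map_add, map_add, H.proj1_of_mem_V hx, H.proj1_of_mem_V hy,
        H.proj1_of_mem_W hz₁, H.proj1_of_mem_W hz₂, add_zero, add_zero] at h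
      rwa [div_le_iff₀' hC]
    rw [div_le_iff₀ hC, zero_mul] at hle
    exact (sub_eq_zero.mp (hF_def _ (le_antisymm hle (hnonneg _)))).symm
  · rintro rfl
    have hz : (60 : ℝ) • (z₂ - z₁) ∈ H.W := H.W.smul_mem _ (H.W.sub_mem hz₂ hz₁)
    refine le_antisymm (le_of_forall_pos_le_add fun δ hδ => ?_) (Real.sInf_nonneg ?_)
    · set K := c₁ * ‖H.Jmap ((60 : ℝ) • (z₂ - z₁))‖ with hK
      have hK0 : 0 ≤ K := by positivity
      obtain ⟨u, w, huw, hu, hw⟩ := H.exists_bracket_eq_map_le hF_smul hc₁.le hF_cont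
        (fun ε hε => H.exists_mem_V_map_le hcont hnonneg hF_smul hF_def hC hF_proj
          h_strictly_weak hε) hz (ε := δ / (1 + K)) (by positivity)
      have hlen := H.finslerLength_commutatorCurve_le hF_add hF_smul hcont (x + z₁) u w
      have hsum : δ / (1 + K) + K * (δ / (1 + K)) = δ := by field_simp
      rw [← hK] at hw
      refine le_trans (csInf_le ⟨0, ?_⟩
        ⟨H.commutatorCurve (x + z₁) u w, ?_, ?_, rfl⟩) (by linarith)
      · rintro _ ⟨γ, -, -, rfl⟩
        exact finslerLength_nonneg H hnonneg γ
      · simp [HTypeGroup.commutatorCurve]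
      · simp only [HTypeGroup.commutatorCurve, huw]
        module
    · rintro _ ⟨γ, -, -, rfl⟩
      exact finslerLength_nonneg H hnonneg γ
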